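/- arXiv:2002.11266 — 6 statements merged into one kernel-verified Lean document; each statement's English description precedes it below -/
import Mathlib

section
/- Let n ≥ 3 and let F be a nonempty Sperner family of subsets of [n] whose maximum member size u satisfies u ≥ ⌈n/2⌉. Then for every integer i with ⌈n/2⌉ ≤ i ≤ u, setting F_+^i = {B ∈ F : |B| ≥ i}, one has |Δ_i(F_+^i)| ≥ |F_+^i| + i(u − i). -/
/-- A family of subsets is a Sperner family (antichain): no member is a subset of
another member unless they are equal. -/
def IsSperner {n : ℕ} (F : Finset (Finset (Fin n))) : Prop :=
  ∀ A ∈ F, ∀ B ∈ F, A ⊆ B → A = B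

/-- The `r`-shadow of a family `G`: all `r`-element subsets of `[n]` contained in
some member of `G`. -/
def shadow {n : ℕ} (G : Finset (Finset (Fin n))) (r : ℕ) : Finset (Finset (Fin n)) :=
  Finset.univ.filter fun B => B.card = r ∧ ∃ A ∈ G, B ⊆ A

/-- The number of members of an `(i + 1)`-uniform family containing a given `i`-set is at most
the number of points outside that `i`-set. -/
theorem card_filter_superset_le {n i : ℕ} {G : Finset (Finset (Fin n))}
    (hG : ∀ A ∈ G, A.card = i + 1) {B : Finset (Fin n)} (hB : B.card = i) :
    (G.filter fun A => B ⊆ A).card ≤ n - i := by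
  have hsub : (G.filter fun A => B ⊆ A) ⊆ Bᶜ.image fun x => insert x B := by
    intro A hA
    obtain ⟨hAG, hBA⟩ := Finset.mem_filter.1 hA
    obtain ⟨x, hx, rfl⟩ := (Finset.covBy_iff_exists_insert (s := B) (t := A)).1
      (Finset.covBy_iff_card_sdiff_eq_one.2 ⟨hBA, by
        rw [Finset.card_sdiff_of_subset hBA, hG A hAG, hB]; omega⟩)
    exact Finset.mem_image.2 ⟨x, Finset.mem_compl.2 hx, rfl⟩
  calc (G.filter fun A => B ⊆ A).card ≤ (Bᶜ.image fun x => insert x B).card :=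
        Finset.card_le_card hsub
    _ ≤ Bᶜ.card := Finset.card_image_le
    _ = n - i := by rw [Finset.card_compl, Fintype.card_fin, hB]

/-- Two distinct `(i + 1)`-sets have at most one common `i`-subset. -/
theorem card_filter_powersetCard_subset_le_one {α : Type*} [DecidableEq α] {i : ℕ}
    {A C : Finset α} (hA : A.card = i + 1) (hC : C.card = i + 1) (hne : A ≠ C) :
    ((C.powersetCard i).filter fun B => B ⊆ A).card ≤ 1 := by
  have hlt : (A ∩ C).card < i + 1 := by
    rw [← hA]
    refine Finset.card_lt_card (Finset.inter_subset_left.ssubset_of_ne fun h => hne ?_)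
    exact Finset.eq_of_subset_of_card_le (Finset.inter_eq_left.1 h) (by omega)
  have key : ∀ B ∈ (C.powersetCard i).filter fun B => B ⊆ A, B = A ∩ C := by
    intro B hB
    obtain ⟨hBC, hBA⟩ := Finset.mem_filter.1 hB
    obtain ⟨hBC, hBi⟩ := Finset.mem_powersetCard.1 hBC
    exact Finset.eq_of_subset_of_card_le (Finset.subset_inter hBA hBC) (by omega)
  exact Finset.card_le_one.2 fun B hB B' hB' => (key B hB).trans (key B' hB').symm

/-- The shadow of a nonempty `(i + 1)`-uniform family on at most `2 * i` points exceeds the family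
in size by at least `i`. -/
theorem card_add_le_card_shadow {n i : ℕ} (hi : 0 < i) (hn : n ≤ 2 * i)
    {G : Finset (Finset (Fin n))} (hG : ∀ A ∈ G, A.card = i + 1) (hne : G.Nonempty) :
    G.card + i ≤ (shadow G i).card := by
  obtain ⟨C, hC⟩ := hne
  set d : Finset (Fin n) → ℕ := fun B => (G.filter fun A => B ⊆ A).card with hd
  have hmem : ∀ A ∈ G, A.powersetCard i ⊆ shadow G i := by
    intro A hA B hB
    obtain ⟨hBA, hBi⟩ := Finset.mem_powersetCard.1 hB
    exact Finset.mem_filter.2 ⟨Finset.mem_univ _, hBi, A, hA, hBA⟩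
  have hcard : ∀ A ∈ G, (A.powersetCard i).card = i + 1 := by
    intro A hA
    rw [Finset.card_powersetCard, hG A hA, Nat.choose_succ_self_right]
  have hdouble : ∀ S : Finset (Finset (Fin n)),
      ∑ B ∈ S, d B = ∑ A ∈ G, (S.filter fun B => B ⊆ A).card := fun S =>
    Finset.sum_card_bipartiteAbove_eq_sum_card_bipartiteBelow
      fun B A : Finset (Fin n) => B ⊆ A
  have htotal : ∑ B ∈ shadow G i, d B = G.card * (i + 1) := by
    rw [hdouble, ← smul_eq_mul, ← Finset.sum_const]
    refine Finset.sum_congr rfl fun A hA => ?_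
    rw [← hcard A hA]
    congr 1
    ext B
    constructor
    · intro hB
      obtain ⟨hB, hBA⟩ := Finset.mem_filter.1 hB
      exact Finset.mem_powersetCard.2 ⟨hBA, (Finset.mem_filter.1 hB).2.1⟩
    · intro hB
      exact Finset.mem_filter.2 ⟨hmem A hA hB, (Finset.mem_powersetCard.1 hB).1⟩
  have hlocal : ∑ B ∈ C.powersetCard i, d B ≤ i + G.card := by
    have hrest : ∑ A ∈ G.erase C, ((C.powersetCard i).filter fun B => B ⊆ A).card
        ≤ (G.erase C).card := by
      rw [Finset.card_eq_sum_ones]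
      refine Finset.sum_le_sum fun A hA => ?_
      obtain ⟨hAC, hA⟩ := Finset.mem_erase.1 hA
      exact card_filter_powersetCard_subset_le_one (hG A hA) (hG C hC) hAC
    have hself : ((C.powersetCard i).filter fun B => B ⊆ C).card ≤ i + 1 :=
      (Finset.card_filter_le _ _).trans (hcard C hC).le
    have herase := Finset.card_erase_add_one hC
    rw [hdouble, ← Finset.add_sum_erase G _ hC]
    omega
  have hdeficit : ∑ B ∈ C.powersetCard i, ((i : ℤ) - d B)
      ≤ ∑ B ∈ shadow G i, ((i : ℤ) - d B) := by
    refine Finset.sum_le_sum_of_subset_of_nonneg (hmem C hC) fun B hB _ => ?_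
    have := card_filter_superset_le hG (Finset.mem_filter.1 hB).2.1
    simp only [hd]
    omega
  rw [Finset.sum_sub_distrib, Finset.sum_sub_distrib, Finset.sum_const, Finset.sum_const,
    hcard C hC, ← Nat.cast_sum, ← Nat.cast_sum, htotal, nsmul_eq_mul, nsmul_eq_mul] at hdeficit
  push_cast at hdeficit
  have hlocal' : (∑ B ∈ C.powersetCard i, (d B : ℤ)) ≤ i + G.card := by exact_mod_cast hlocal
  have hmul : (i : ℤ) * (G.card + i) ≤ i * (shadow G i).card := by linarith
  exact_mod_cast le_of_mul_le_mul_left hmul (by exact_mod_cast hi)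

/-- The `i`-element members of a Sperner family are disjoint from the `i`-shadow of the larger
members. -/
theorem IsSperner.card_add_card_shadow_le {n : ℕ} {F : Finset (Finset (Fin n))}
    (hS : IsSperner F) (i : ℕ) :
    (F.filter fun B => B.card = i).card +
        (shadow (shadow (F.filter fun B => i + 1 ≤ B.card) (i + 1)) i).card ≤
      (shadow (F.filter fun B => i ≤ B.card) i).card := by
  have hshadow : ∀ B ∈ shadow (shadow (F.filter fun B => i + 1 ≤ B.card) (i + 1)) i,
      B.card = i ∧ ∃ A ∈ F, i + 1 ≤ A.card ∧ B ⊆ A := by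
    intro B hB
    obtain ⟨-, hBi, D, hD, hBD⟩ := Finset.mem_filter.1 hB
    obtain ⟨-, -, A, hA, hDA⟩ := Finset.mem_filter.1 hD
    obtain ⟨hA, hAi⟩ := Finset.mem_filter.1 hA
    exact ⟨hBi, A, hA, hAi, hBD.trans hDA⟩
  rw [← Finset.card_union_of_disjoint]
  · refine Finset.card_le_card fun B hB => ?_
    rcases Finset.mem_union.1 hB with hB | hB
    · obtain ⟨hBF, hBi⟩ := Finset.mem_filter.1 hB
      exact Finset.mem_filter.2 ⟨Finset.mem_univ _, hBi, B,
        Finset.mem_filter.2 ⟨hBF, hBi.ge⟩, subset_rfl⟩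
    · obtain ⟨hBi, A, hA, hAi, hBA⟩ := hshadow B hB
      exact Finset.mem_filter.2 ⟨Finset.mem_univ _, hBi, A,
        Finset.mem_filter.2 ⟨hA, by omega⟩, hBA⟩
  · refine Finset.disjoint_left.2 fun B hB hB' => ?_
    obtain ⟨hBF, hBi⟩ := Finset.mem_filter.1 hB
    obtain ⟨-, A, hA, hAi, hBA⟩ := hshadow B hB'
    have := hS B hBF A hA hBA
    subst this
    omega

/-- For `n ≥ 3` and a nonempty Sperner family `F` with maximum member size
`u ≥ ⌈n/2⌉`, for every `i` with `⌈n/2⌉ ≤ i ≤ u`, the family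
`F₊ⁱ = {B ∈ F : |B| ≥ i}` satisfies `|Δᵢ(F₊ⁱ)| ≥ |F₊ⁱ| + i(u-i)`. -/
theorem sperner_shadow_lower_bound {n u : ℕ} (hn : 3 ≤ n)
    (F : Finset (Finset (Fin n))) (hne : F.Nonempty) (hS : IsSperner F)
    (humax : ∀ A ∈ F, A.card ≤ u) (huatt : ∃ A ∈ F, A.card = u)
    (hu : (n + 1) / 2 ≤ u) :
    ∀ i : ℕ, (n + 1) / 2 ≤ i → i ≤ u →
      (F.filter fun B => i ≤ B.card).card + i * (u - i) ≤
        (shadow (F.filter fun B => i ≤ B.card) i).card := by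
  intro i hi hiu
  obtain ⟨m, hm⟩ := Nat.exists_eq_add_of_le hiu
  induction m generalizing i with
  | zero =>
    have hui : u - i = 0 := by omega
    rw [hui, Nat.mul_zero, Nat.add_zero]
    refine Finset.card_le_card fun B hB => ?_
    obtain ⟨hBF, hBi⟩ := Finset.mem_filter.1 hB
    have := humax B hBF
    exact Finset.mem_filter.2 ⟨Finset.mem_univ _, by omega, B, hB, subset_rfl⟩
  | succ m ih =>
    have hstep := ih (i + 1) (by omega) (by omega) (by omega)
    have hnonempty : (shadow (F.filter fun B => i + 1 ≤ B.card) (i + 1)).Nonempty := by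
      obtain ⟨A, hA, hAu⟩ := huatt
      obtain ⟨D, hDA, hD⟩ := Finset.exists_subset_card_eq (s := A) (n := i + 1) (by omega)
      exact ⟨D, Finset.mem_filter.2 ⟨Finset.mem_univ _, hD, A,
        Finset.mem_filter.2 ⟨hA, by omega⟩, hDA⟩⟩
    have hexpand := card_add_le_card_shadow (i := i) (by omega) (by omega)
      (fun A hA => (Finset.mem_filter.1 hA).2.1) hnonempty
    have hsplit : (F.filter fun B => i ≤ B.card).card ≤
        (F.filter fun B => B.card = i).card + (F.filter fun B => i + 1 ≤ B.card).card := by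
      refine (Finset.card_le_card fun B hB => ?_).trans (Finset.card_union_le _ _)
      obtain ⟨hBF, hBi⟩ := Finset.mem_filter.1 hB
      rcases hBi.eq_or_lt with h | h
      · exact Finset.mem_union_left _ (Finset.mem_filter.2 ⟨hBF, h.symm⟩)
      · exact Finset.mem_union_right _ (Finset.mem_filter.2 ⟨hBF, h⟩)
    have hlevel := hS.card_add_card_shadow_le i
    have hu₀ : u - i = m + 1 := by omega
    have hu₁ : u - (i + 1) = m := by omega
    rw [hu₁] at hstep
    rw [hu₀]
    linarith
end

section
/- Let q ≥ 2 and let C = {c^1,…,c^m} be an (n,m,q) code with pairwise distinct codewords. Then C is a wide-sense 2-frameproof code if and only if for every i ∈ {1,…,m} and all j, k ∈ {1,…,m} with j ≠ i and k ≠ i the following hold: (a) if j ≠ k then neither of I(i,j) and I(i,k) is a subset of the other (in particular I(i,j) ≠ I(i,k)), and (b) I(i,j) ∪ I(i,k) ≠ {1,…,n}. (That is, C is 2-wFP iff each coincidence family {I(i,j) : j ≠ i} consists of pairwise incomparable sets and is non 2-covering.) -/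
/-- The wide-sense descendant set of a set `X` of words: all words agreeing with the
words of `X` on every position undetectable for `X` (i.e. where all words of `X` agree). -/
def wdesc {n : ℕ} {Q : Type*} (X : Finset (Fin n → Q)) : Set (Fin n → Q) :=
  {y | ∀ i : Fin n, (∀ x ∈ X, ∀ x' ∈ X, x i = x' i) → ∀ x ∈ X, y i = x i}

/-- A code `C` is wide-sense 2-frameproof if `wdesc X ∩ C = X` for every nonempty
subset `X ⊆ C` with `|X| ≤ 2`. -/
def IsWFP2 {n : ℕ} {Q : Type*} (C : Finset (Fin n → Q)) : Prop :=
  ∀ X : Finset (Fin n → Q), X ⊆ C → X.Nonempty → X.card ≤ 2 →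
    wdesc X ∩ (C : Set (Fin n → Q)) = (X : Set (Fin n → Q))

/-- The coincidence set of two words: the set of positions where they agree. -/
def coin {n : ℕ} {Q : Type*} [DecidableEq Q] (x y : Fin n → Q) : Finset (Fin n) :=
  Finset.univ.filter fun k => x k = y k

theorem mem_coin {n : ℕ} {Q : Type*} [DecidableEq Q] {x y : Fin n → Q} {t : Fin n} :
    t ∈ coin x y ↔ x t = y t := by
  simp [coin]

theorem mem_wdesc_pair_iff {n : ℕ} {Q : Type*} [DecidableEq Q] {x y z : Fin n → Q} :
    z ∈ wdesc {x, y} ↔ coin x y ⊆ coin x z := by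
  simp only [wdesc, Set.mem_ofPred_eq, Finset.mem_insert, Finset.mem_singleton, forall_eq_or_imp,
    forall_eq, Finset.subset_iff, mem_coin]
  grind

theorem subset_wdesc {n : ℕ} {Q : Type*} (X : Finset (Fin n → Q)) :
    (X : Set (Fin n → Q)) ⊆ wdesc X :=
  fun _ hx _ ht x' hx' => ht _ hx x' hx'

theorem Finset.Nonempty.exists_eq_pair_of_card_le_two {α : Type*} [DecidableEq α] {X : Finset α}
    (hX : X.Nonempty) (hcard : X.card ≤ 2) : ∃ a b, X = {a, b} := by
  have hpos := hX.card_pos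
  obtain h | h : X.card = 1 ∨ X.card = 2 := by omega
  · obtain ⟨a, rfl⟩ := Finset.card_eq_one.1 h
    exact ⟨a, a, by simp⟩
  · obtain ⟨a, b, -, rfl⟩ := Finset.card_eq_two.1 h
    exact ⟨a, b, rfl⟩

theorem isWFP2_iff_pair {n : ℕ} {Q : Type*} [DecidableEq Q] {C : Finset (Fin n → Q)} :
    IsWFP2 C ↔ ∀ x ∈ C, ∀ y ∈ C, ∀ z ∈ C, coin x y ⊆ coin x z → z = x ∨ z = y := by
  constructor
  · intro h x hx y hy z hz hsub
    have hX := h {x, y} (by simp [Finset.insert_subset_iff, hx, hy]) (by simp)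
      Finset.card_le_two
    have hmem : z ∈ (({x, y} : Finset (Fin n → Q)) : Set (Fin n → Q)) :=
      hX ▸ ⟨mem_wdesc_pair_iff.2 hsub, hz⟩
    simpa using hmem
  · intro h X hXC hne hcard
    refine Set.Subset.antisymm ?_ fun z hz => ⟨subset_wdesc X hz, hXC hz⟩
    obtain ⟨x, y, rfl⟩ := hne.exists_eq_pair_of_card_le_two hcard
    rintro z ⟨hz, hzC⟩
    simpa using h x (hXC (by simp)) y (hXC (by simp)) z hzC (mem_wdesc_pair_iff.1 hz)

/-- A code `C = {c 1, …, c m}` of distinct words is wide-sense 2-frameproof iff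
for all `i` and all `j, k ≠ i`: the coincidence sets `I(i,j)` and `I(i,k)` are
incomparable when `j ≠ k`, and `I(i,j) ∪ I(i,k) ≠ [n]`; i.e. each coincidence
family `{I(i,j) : j ≠ i}` is a non 2-covering Sperner family. -/
theorem wfp2_iff_coincidence_families {n m q : ℕ} {Q : Type*} [Fintype Q] [DecidableEq Q]
    (hq : Fintype.card Q = q) (hq2 : 2 ≤ q)
    (c : Fin m → (Fin n → Q)) (hinj : Function.Injective c) :
    IsWFP2 (Finset.image c Finset.univ) ↔
      ∀ i j k : Fin m, j ≠ i → k ≠ i →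
        (j ≠ k → ¬ coin (c i) (c j) ⊆ coin (c i) (c k) ∧
          ¬ coin (c i) (c k) ⊆ coin (c i) (c j)) ∧
        coin (c i) (c j) ∪ coin (c i) (c k) ≠ Finset.univ := by
  simp only [isWFP2_iff_pair, Finset.forall_mem_image, Finset.mem_univ, true_imp_iff,
    hinj.eq_iff]
  constructor
  · intro h i j k hji hki
    refine ⟨fun hjk => ⟨fun hsub => ?_, fun hsub => ?_⟩, fun hcov => ?_⟩
    · exact (@h i j k hsub).elim hki hjk.symm
    · exact (@h i k j hsub).elim hji hjk
    · refine (@h j k i fun t ht => ?_).elim hji.symm hki.symm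
      have hmem := hcov ▸ Finset.mem_univ t
      simp only [Finset.mem_union, mem_coin] at hmem ht ⊢
      grind
  · intro h i j k hsub
    by_contra! hne
    obtain ⟨hki, hkj⟩ := hne
    obtain rfl | hji := eq_or_ne j i
    · refine hki (hinj (funext fun t => ?_))
      exact (mem_coin.1 (hsub (mem_coin.2 rfl))).symm
    · exact ((h i j k hji hki).1 hkj.symm).1 hsub
end

section
/- Let n ≥ 1 and let F be a Sperner family of subsets of [n]. If some member of F has size exactly 1, then |F| ≤ (n−1 choose ⌊(n−1)/2⌋) + 1. -/
/-- Restricting an antichain of sets that avoid `a` to the complement of `a` gives Sperner's bound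
for a ground set with one element fewer. -/
theorem IsAntichain.sperner_of_notMem {α : Type*} [Fintype α] [DecidableEq α]
    {F : Finset (Finset α)} (hF : IsAntichain (· ⊆ ·) (SetLike.coe F)) {a : α}
    (ha : ∀ B ∈ F, a ∉ B) :
    F.card ≤ (Fintype.card α - 1).choose ((Fintype.card α - 1) / 2) := by
  have hsub : ∀ B ∈ F, ∀ C ∈ F,
      B.subtype (· ≠ a) ⊆ C.subtype (· ≠ a) → B = C := by
    intro B hB C hC hBC
    refine hF.eq hB hC fun x hx => ?_
    have hxa : x ≠ a := fun hxa => ha B hB (hxa ▸ hx)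
    exact Finset.mem_subtype.1 (hBC (Finset.mem_subtype (a := ⟨x, hxa⟩) |>.2 hx))
  have hcard : (F.image (Finset.subtype (· ≠ a))).card = F.card :=
    Finset.card_image_of_injOn fun B hB C hC hBC => hsub B hB C hC hBC.subset
  have hanti : IsAntichain (· ⊆ ·) (SetLike.coe (F.image (Finset.subtype (· ≠ a)))) := by
    intro S hS T hT hne hST
    obtain ⟨B, hB, rfl⟩ := Finset.mem_image.1 hS
    obtain ⟨C, hC, rfl⟩ := Finset.mem_image.1 hT
    exact hne (congrArg _ (hsub B hB C hC hST))
  have hα : Fintype.card {x // x ≠ a} = Fintype.card α - 1 := by simp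
  simpa only [hcard, hα] using hanti.sperner


/-- A Sperner family over `[n]` (`n ≥ 1`) containing a singleton has
`|F| ≤ C(n-1, ⌊(n-1)/2⌋) + 1`. -/
theorem sperner_with_singleton {n : ℕ} (hn : 1 ≤ n)
    (F : Finset (Finset (Fin n))) (hS : IsSperner F)
    (h : ∃ A ∈ F, A.card = 1) :
    F.card ≤ (n - 1).choose ((n - 1) / 2) + 1 := by
  obtain ⟨A, hA, hA1⟩ := h
  obtain ⟨a, rfl⟩ := Finset.card_eq_one.1 hA1
  have hanti : IsAntichain (· ⊆ ·) (SetLike.coe (F.erase {a})) := fun B hB C hC hne hBC =>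
    hne (hS B (Finset.mem_of_mem_erase hB) C (Finset.mem_of_mem_erase hC) hBC)
  have ha : ∀ B ∈ F.erase {a}, a ∉ B := fun B hB haB =>
    Finset.ne_of_mem_erase hB
      (hS {a} hA B (Finset.mem_of_mem_erase hB) (Finset.singleton_subset_iff.2 haB)).symm
  have hle := hanti.sperner_of_notMem ha
  rw [Fintype.card_fin] at hle
  rw [← Finset.card_erase_add_one hA]
  exact Nat.add_le_add_right hle 1
end

section
/- (Milner's theorem) Let k ≥ 1 and let F be a k-intersecting Sperner family of subsets of [n]. Then |F| ≤ (n choose ⌊(n+k+1)/2⌋). -/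
open Finset
open scoped FinsetFamily

section Shadow

variable {α : Type*} [DecidableEq α] [Fintype α] {𝒜 : Finset (Finset α)} {r : ℕ}

/-- Weights on an `r`-uniform family which sum to zero over the members above any set of the shadow
also sum to zero over the members above any set with fewer than `r` elements. -/
lemma sum_superset_eq_zero (h𝒜 : (𝒜 : Set (Finset α)).Sized r) {c : Finset α → ℚ}
    (hc : ∀ T ∈ ∂ 𝒜, ∑ A ∈ 𝒜 with T ⊆ A, c A = 0) {S : Finset α} (hS : #S < r) :
    ∑ A ∈ 𝒜 with S ⊆ A, c A = 0 := by
  obtain ⟨d, hd⟩ : ∃ d, #S + d + 1 = r := ⟨r - #S - 1, by omega⟩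
  induction d generalizing S with
  | zero =>
    by_cases hT : S ∈ ∂ 𝒜
    · exact hc S hT
    · refine sum_eq_zero fun A hA ↦ (hT ?_).elim
      rw [mem_filter] at hA
      exact mem_shadow_iff_exists_mem_card_add_one.2 ⟨A, hA.1, hA.2, by rw [h𝒜 hA.1]; omega⟩
  | succ d ih =>
    have hzero : ∑ x ∈ Sᶜ, ∑ A ∈ 𝒜 with insert x S ⊆ A, c A = 0 := by
      refine sum_eq_zero fun x hx ↦ ?_
      have hcard : #(insert x S) = #S + 1 := card_insert_of_notMem (by simpa using hx)
      exact ih (by omega) (by omega)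
    have hcount : ∑ x ∈ Sᶜ, ∑ A ∈ 𝒜 with insert x S ⊆ A, c A
        = (d + 2) * ∑ A ∈ 𝒜 with S ⊆ A, c A := by
      simp_rw [sum_filter]
      rw [sum_comm, mul_sum]
      refine sum_congr rfl fun A hA ↦ ?_
      rw [← sum_filter, sum_const, nsmul_eq_mul]
      by_cases hSA : S ⊆ A
      · have hfil : {x ∈ Sᶜ | insert x S ⊆ A} = A \ S := by
          ext x
          simp only [mem_filter, mem_compl, insert_subset_iff, mem_sdiff]
          tauto
        have hcard : #(A \ S) = d + 2 := by
          rw [card_sdiff_of_subset hSA, h𝒜 hA]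
          omega
        rw [hfil, hcard, if_pos hSA]
        push_cast
        ring
      · have hfil : {x ∈ Sᶜ | insert x S ⊆ A} = ∅ :=
          filter_eq_empty_iff.2 fun x _ h ↦ hSA ((subset_insert x S).trans h)
        simp [hfil, hSA]
    rw [hcount] at hzero
    exact (mul_eq_zero.1 hzero).resolve_left (by positivity)

/-- Weights on an intersecting `r`-uniform family vanish if they sum to zero over the members above
any set of the shadow. -/
lemma eq_zero_of_sum_superset_eq_zero (h𝒜 : (𝒜 : Set (Finset α)).Sized r)
    (hint : ∀ A ∈ 𝒜, ∀ B ∈ 𝒜, (A ∩ B).Nonempty) {c : Finset α → ℚ}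
    (hc : ∀ T ∈ ∂ 𝒜, ∑ A ∈ 𝒜 with T ⊆ A, c A = 0) {B : Finset α} (hB : B ∈ 𝒜) : c B = 0 := by
  have hsum : ∑ S ∈ B.ssubsets, (-1 : ℚ) ^ #S * ∑ A ∈ 𝒜 with S ⊆ A, c A = 0 := by
    refine sum_eq_zero fun S hS ↦ ?_
    rw [sum_superset_eq_zero h𝒜 hc (by rw [← h𝒜 hB]; exact card_lt_card (mem_ssubsets.1 hS)),
      mul_zero]
  have halt (A : Finset α) (hA : A ∈ 𝒜) :
      ∑ S ∈ (A ∩ B).powerset, (-1 : ℚ) ^ #S = 0 := by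
    exact_mod_cast sum_powerset_neg_one_pow_card_of_nonempty (hint A hA B hB)
  have hcoeff (A : Finset α) (hA : A ∈ 𝒜) :
      ∑ S ∈ B.ssubsets with S ⊆ A, (-1 : ℚ) ^ #S = if A = B then -(-1) ^ #B else 0 := by
    have hfil : {S ∈ B.ssubsets | S ⊆ A} = (A ∩ B).powerset.erase B := by
      ext S
      simp only [mem_filter, mem_ssubsets, mem_erase, mem_powerset, subset_inter_iff,
        ssubset_iff_subset_ne]
      tauto
    rw [hfil]
    split_ifs with hAB
    · subst hAB
      rw [sum_erase_eq_sub (by simp), halt A hA, zero_sub]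
    · rw [erase_eq_of_notMem, halt A hA]
      rw [mem_powerset, subset_inter_iff]
      exact fun h ↦ hAB (eq_of_subset_of_card_le h.1 (by rw [h𝒜 hA, h𝒜 hB])).symm
  have hexpand : ∑ S ∈ B.ssubsets, (-1 : ℚ) ^ #S * ∑ A ∈ 𝒜 with S ⊆ A, c A
      = ∑ A ∈ 𝒜, (∑ S ∈ B.ssubsets with S ⊆ A, (-1 : ℚ) ^ #S) * c A := by
    simp_rw [sum_filter, mul_sum, sum_mul]
    rw [sum_comm]
    refine sum_congr rfl fun A _ ↦ sum_congr rfl fun S _ ↦ ?_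
    split_ifs <;> simp
  rw [hexpand, sum_congr rfl fun A hA ↦ by rw [hcoeff A hA]] at hsum
  simpa [hB] using hsum

/-- **Katona's shadow theorem** for intersecting uniform families: the shadow is at least as large
as the family. -/
theorem card_le_card_shadow_of_intersecting (h𝒜 : (𝒜 : Set (Finset α)).Sized r)
    (hint : ∀ A ∈ 𝒜, ∀ B ∈ 𝒜, (A ∩ B).Nonempty) : #𝒜 ≤ #(∂ 𝒜) := by
  let v (A : 𝒜) (T : ∂ 𝒜) : ℚ := if T.1 ⊆ A.1 then 1 else 0
  have hv : LinearIndependent ℚ v := by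
    refine Fintype.linearIndependent_iff.2 fun g hg B ↦ ?_
    let c (A : Finset α) : ℚ := if hA : A ∈ 𝒜 then g ⟨A, hA⟩ else 0
    have hc : ∀ T ∈ ∂ 𝒜, ∑ A ∈ 𝒜 with T ⊆ A, c A = 0 := by
      intro T hT
      have := congrFun hg ⟨T, hT⟩
      rw [sum_filter, ← sum_coe_sort]
      simpa [v, c] using this
    simpa [c] using eq_zero_of_sum_superset_eq_zero h𝒜 hint hc B.2
  simpa using hv.fintype_card_le_finrank

/-- A uniform family in which no two members cover the ground set is no larger than its upper
shadow. -/
theorem card_le_card_upShadow_of_union_ne_univ (h𝒜 : (𝒜 : Set (Finset α)).Sized r)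
    (hunion : ∀ A ∈ 𝒜, ∀ B ∈ 𝒜, A ∪ B ≠ univ) : #𝒜 ≤ #(∂⁺ 𝒜) := by
  have h := card_le_card_shadow_of_intersecting h𝒜.compls fun A hA B hB ↦ by
    refine nonempty_iff_ne_empty.2 fun hAB ↦ hunion _ (mem_compls.1 hA) _ (mem_compls.1 hB) ?_
    rw [← compl_inter, hAB, compl_empty]
  simpa using h

end Shadow

/-- LYM bound for an antichain whose members all have size at least `s ≥ n / 2`. -/
lemma card_le_choose_of_le_card {α : Type*} [Fintype α] {𝒜 : Finset (Finset α)} {s : ℕ}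
    (hanti : IsAntichain (· ⊆ ·) (𝒜 : Set (Finset α))) (hs : Fintype.card α ≤ 2 * s)
    (hcard : ∀ A ∈ 𝒜, s ≤ #A) : #𝒜 ≤ (Fintype.card α).choose s := by
  have hle {m : ℕ} (hm : s ≤ m) :
      (Fintype.card α).choose m ≤ (Fintype.card α).choose s := by
    induction m, hm using Nat.le_induction with
    | base => rfl
    | succ m hm ih =>
      refine le_trans ?_ ih
      refine Nat.le_of_mul_le_mul_right ?_ m.succ_pos
      rw [Nat.succ_eq_add_one, Nat.choose_succ_right_eq]
      exact Nat.mul_le_mul_left _ (by omega)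
  have hlym := lubell_yamamoto_meshalkin_inequality_sum_inv_choose (𝕜 := ℚ) hanti
  have hpos {A : Finset α} : 0 < (Fintype.card α).choose #A := Nat.choose_pos A.card_le_univ
  rcases 𝒜.eq_empty_or_nonempty with rfl | ⟨A₀, hA₀⟩
  · simp
  have hspos : (0 : ℚ) < (Fintype.card α).choose s := by
    exact_mod_cast hpos.trans_le (hle (hcard A₀ hA₀))
  have hbound : (#𝒜 : ℚ) * ((Fintype.card α).choose s : ℚ)⁻¹ ≤ 1 := by
    rw [← nsmul_eq_mul, ← sum_const]
    refine (sum_le_sum fun A hA ↦ ?_).trans hlym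
    exact inv_anti₀ (by exact_mod_cast hpos) (by exact_mod_cast hle (hcard A hA))
  rw [← div_eq_mul_inv, div_le_one hspos] at hbound
  exact_mod_cast hbound

/-- Replacing the members of size `r` of a `k`-intersecting Sperner family, all of whose members
have at least `r` elements, by their upper shadow. -/
lemma exists_isSperner_of_le_card {n k r : ℕ} (hr : 2 * r + 1 ≤ n + k)
    {F : Finset (Finset (Fin n))} (hS : IsSperner F)
    (hint : ∀ A ∈ F, ∀ B ∈ F, k ≤ #(A ∩ B)) (hcard : ∀ A ∈ F, r ≤ #A) :
    ∃ G : Finset (Finset (Fin n)), IsSperner G ∧ (∀ A ∈ G, ∀ B ∈ G, k ≤ #(A ∩ B)) ∧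
      (∀ A ∈ G, r + 1 ≤ #A) ∧ #F ≤ #G := by
  set L := {A ∈ F | #A = r}
  set U := {A ∈ F | #A ≠ r}
  have hLsized : (L : Set (Finset (Fin n))).Sized r := fun A hA ↦ (mem_filter.1 hA).2
  have hUcard {A : Finset (Fin n)} (hA : A ∈ U) : r + 1 ≤ #A := by
    have := hcard A (mem_filter.1 hA).1
    have := (mem_filter.1 hA).2
    omega
  have hupcard {A : Finset (Fin n)} (hA : A ∈ ∂⁺ L) : #A = r + 1 := hLsized.upShadow hA
  have hnot {A B : Finset (Fin n)} (hA : A ∈ ∂⁺ L) (hB : B ∈ U) : ¬ A ⊆ B := by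
    intro hAB
    obtain ⟨C, hC, hCA⟩ := exists_subset_of_mem_upShadow hA
    rw [mem_filter] at hC hB
    exact hB.2 (hS C hC.1 B hB.1 (hCA.trans hAB) ▸ hC.2)
  have hbelow {A : Finset (Fin n)} (hA : A ∈ U ∪ ∂⁺ L) : ∃ C ∈ F, C ⊆ A := by
    rcases mem_union.1 hA with hA | hA
    · exact ⟨A, (mem_filter.1 hA).1, subset_rfl⟩
    · obtain ⟨C, hC, hCA⟩ := exists_subset_of_mem_upShadow hA
      exact ⟨C, (mem_filter.1 hC).1, hCA⟩
  refine ⟨U ∪ ∂⁺ L, ?_, ?_, ?_, ?_⟩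
  · intro A hA B hB hAB
    rcases mem_union.1 hA with hA | hA <;> rcases mem_union.1 hB with hB | hB
    · exact hS A (mem_filter.1 hA).1 B (mem_filter.1 hB).1 hAB
    · exact eq_of_subset_of_card_le hAB (by rw [hupcard hB]; exact hUcard hA)
    · exact (hnot hA hB hAB).elim
    · exact eq_of_subset_of_card_le hAB (by rw [hupcard hA, hupcard hB])
  · intro A hA B hB
    obtain ⟨C, hC, hCA⟩ := hbelow hA
    obtain ⟨D, hD, hDB⟩ := hbelow hB
    exact (hint C hC D hD).trans (card_le_card (inter_subset_inter hCA hDB))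
  · intro A hA
    rcases mem_union.1 hA with hA | hA
    · exact hUcard hA
    · exact (hupcard hA).ge
  · have hdisj : Disjoint U (∂⁺ L) := disjoint_left.2 fun A hA hA' ↦ hnot hA' hA subset_rfl
    have hup : #L ≤ #(∂⁺ L) := by
      refine card_le_card_upShadow_of_union_ne_univ hLsized fun A hA B hB hAB ↦ ?_
      have h := card_union_add_card_inter A B
      rw [hAB, card_univ, Fintype.card_fin, hLsized hA, hLsized hB] at h
      have := hint A (mem_filter.1 hA).1 B (mem_filter.1 hB).1
      omega
    have hsplit : #L + #U = #F := card_filter_add_card_filter_not _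
    rw [card_union_of_disjoint hdisj]
    omega

/-- Milner's theorem: a `k`-intersecting Sperner family over `[n]` (`k ≥ 1`) has
`|F| ≤ C(n, ⌊(n+k+1)/2⌋)`. -/
theorem milner_k_intersecting_sperner {n k : ℕ} (hk : 1 ≤ k)
    (F : Finset (Finset (Fin n))) (hS : IsSperner F)
    (hint : ∀ A ∈ F, ∀ B ∈ F, k ≤ (A ∩ B).card) :
    F.card ≤ n.choose ((n + k + 1) / 2) := by
  have hraise : ∀ r ≤ (n + k + 1) / 2, ∃ G : Finset (Finset (Fin n)), IsSperner G ∧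
      (∀ A ∈ G, ∀ B ∈ G, k ≤ #(A ∩ B)) ∧ (∀ A ∈ G, r ≤ #A) ∧ #F ≤ #G := by
    intro r
    induction r with
    | zero => exact fun _ ↦ ⟨F, hS, hint, fun _ _ ↦ Nat.zero_le _, le_rfl⟩
    | succ r ih =>
      intro hr
      obtain ⟨G, hGS, hGint, hGcard, hFG⟩ := ih (by omega)
      obtain ⟨H, hHS, hHint, hHcard, hGH⟩ :=
        exists_isSperner_of_le_card (by omega) hGS hGint hGcard
      exact ⟨H, hHS, hHint, hHcard, hFG.trans hGH⟩
  obtain ⟨G, hGS, -, hGcard, hFG⟩ := hraise _ le_rfl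
  have hanti : IsAntichain (· ⊆ ·) (G : Set (Finset (Fin n))) :=
    fun A hA B hB hne hAB ↦ hne (hGS A hA B hB hAB)
  have h := card_le_choose_of_le_card hanti (by rw [Fintype.card_fin]; omega) hGcard
  rw [Fintype.card_fin] at h
  exact hFG.trans h
end

section
/- (Katona) Let A be an intersecting family of k-element subsets of [n], i.e., every two members of A have nonempty intersection. Then |Δ(A)| ≥ |A|, where Δ(A) = {B ⊆ [n] : |B| = k−1 and B ⊆ A' for some A' ∈ A} is the (k−1)-shadow of A. -/
section IntersectingShadow

open Finset
open scoped FinsetFamily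

variable {α : Type*} [DecidableEq α] {𝒜 : Finset (Finset α)} {S : Finset α} {k : ℕ}

/-- Local LYM inequality relative to a ground set `S` with fewer than `2 * k` elements. -/
theorem card_le_card_shadow_of_card_lt_two_mul (hsub : ∀ s ∈ 𝒜, s ⊆ S)
    (hk : (𝒜 : Set (Finset α)).Sized k) (hS : #S < 2 * k) : #𝒜 ≤ #(∂ 𝒜) := by
  refine Nat.le_of_mul_le_mul_right ?_ (show 0 < k by omega)
  refine card_mul_le_card_mul' (· ⊆ ·) (fun s hs => ?_) (fun t ht => ?_)
  · rw [← hk hs, ← card_image_of_injOn s.erase_injOn]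
    refine card_le_card ?_
    simp_rw [image_subset_iff, mem_bipartiteBelow]
    exact fun a ha => ⟨erase_mem_shadow hs ha, erase_subset _ _⟩
  · have htk : #t = k - 1 := hk.shadow ht
    have htS : t ⊆ S := by
      obtain ⟨s, hs, hts⟩ := exists_subset_of_mem_shadow ht
      exact hts.trans (hsub s hs)
    calc #(bipartiteAbove (· ⊆ ·) 𝒜 t) ≤ #((S \ t).image (insert · t)) := by
          refine card_le_card fun s hs => ?_
          rw [mem_bipartiteAbove] at hs
          have hsk : #s = k := hk hs.1
          obtain ⟨a, ha, rfl⟩ := exists_eq_insert_iff.2 ⟨hs.2, by omega⟩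
          exact mem_image_of_mem _
            (mem_sdiff.2 ⟨hsub _ hs.1 (mem_insert_self a t), ha⟩)
      _ ≤ #(S \ t) := card_image_le
      _ ≤ k := by rw [card_sdiff_of_subset htS]; omega

/-- Shifting one element to another preserves the intersecting property. -/
theorem intersecting_compression_singleton (h : (𝒜 : Set (Finset α)).Intersecting)
    (x a : α) : (𝓒 {x} {a} 𝒜 : Set (Finset α)).Intersecting := by
  have mixed : ∀ s ∈ 𝓒 {x} {a} 𝒜, s ∈ 𝒜 → ∀ t ∈ 𝓒 {x} {a} 𝒜, t ∉ 𝒜 → ¬Disjoint s t := by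
    intro s hs hs𝒜 t ht ht𝒜 hst
    have hxt : x ∈ t := singleton_subset_iff.1 (UV.le_of_mem_compression_of_notMem ht ht𝒜)
    have ht' : (t ∪ {a}) \ {x} ∈ 𝒜 := UV.sup_sdiff_mem_of_mem_compression_of_notMem ht ht𝒜
    have hxs : x ∉ s := fun hxs => disjoint_left.1 hst hxs hxt
    have has : a ∈ s := by
      obtain ⟨y, hys, hyt⟩ := not_disjoint_iff.1 (h hs𝒜 ht')
      have := disjoint_left.1 hst hys
      simp only [mem_sdiff, mem_union, mem_singleton] at hyt
      obtain ⟨hyt | rfl, -⟩ := hyt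
      · exact absurd hyt this
      · exact hys
    have hs' : (s ∪ {x}) \ {a} ∈ 𝒜 :=
      UV.sup_sdiff_mem_of_mem_compression hs (singleton_subset_iff.2 has)
        (disjoint_singleton_left.2 hxs)
    obtain ⟨z, hzs, hzt⟩ := not_disjoint_iff.1 (h hs' ht')
    simp only [mem_sdiff, mem_union, mem_singleton] at hzs hzt
    exact disjoint_left.1 hst (hzs.1.resolve_right hzt.2) (hzt.1.resolve_right hzs.2)
  intro s hs t ht
  rw [mem_coe] at hs ht
  by_cases hs𝒜 : s ∈ 𝒜 <;> by_cases ht𝒜 : t ∈ 𝒜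
  · exact h hs𝒜 ht𝒜
  · exact mixed s hs hs𝒜 t ht ht𝒜
  · exact fun hst => mixed t ht ht𝒜 s hs hs𝒜 hst.symm
  · exact not_disjoint_iff.2 ⟨x,
      singleton_subset_iff.1 (UV.le_of_mem_compression_of_notMem hs hs𝒜),
      singleton_subset_iff.1 (UV.le_of_mem_compression_of_notMem ht ht𝒜)⟩

theorem subset_of_mem_compression_singleton {x a : α} (hx : x ∈ S)
    (hsub : ∀ s ∈ 𝒜, s ⊆ S) : ∀ s ∈ 𝓒 {x} {a} 𝒜, s ⊆ S := by
  intro s hs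
  by_cases hs𝒜 : s ∈ 𝒜
  · exact hsub s hs𝒜
  have h := hsub _ (UV.sup_sdiff_mem_of_mem_compression_of_notMem hs hs𝒜)
  intro y hy
  by_cases hyx : y = x
  · rwa [hyx]
  · exact h (mem_sdiff.2 ⟨mem_union_left _ hy, by simpa using hyx⟩)

theorem card_filter_mem_compression_lt {x a : α} {s : Finset α} (hs : s ∈ 𝒜) (ha : a ∈ s)
    (hx : x ∉ s) (hs' : (s ∪ {x}) \ {a} ∉ 𝒜) :
    #{t ∈ 𝓒 {x} {a} 𝒜 | a ∈ t} < #{t ∈ 𝒜 | a ∈ t} := by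
  refine card_lt_card ((ssubset_iff_of_subset fun t ht => ?_).2 ⟨s, by simp [hs, ha], fun h => ?_⟩)
  · rw [mem_filter] at ht ⊢
    exact ⟨UV.mem_of_mem_compression ht.1 (singleton_subset_iff.2 ht.2) (by simp), ht.2⟩
  · exact hs' (UV.sup_sdiff_mem_of_mem_compression (mem_filter.1 h).1
      (singleton_subset_iff.2 ha) (disjoint_singleton_left.2 hx))

/-- In a family shifted away from `a`, the link of `a` is intersecting. -/
theorem intersecting_memberSubfamily_of_shifted {a : α}
    (h : (𝒜 : Set (Finset α)).Intersecting) (hk : (𝒜 : Set (Finset α)).Sized k)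
    (hS : 2 * k ≤ #S)
    (hshift : ∀ x ∈ S, ∀ s ∈ 𝒜, a ∈ s → x ∉ s → (s ∪ {x}) \ {a} ∈ 𝒜) :
    (𝒜.memberSubfamily a : Set (Finset α)).Intersecting := by
  intro s hs t ht hst
  rw [mem_coe, mem_memberSubfamily] at hs ht
  have hsk : #(insert a s) = k := hk hs.1
  have htk : #(insert a t) = k := hk ht.1
  rw [card_insert_of_notMem hs.2] at hsk
  rw [card_insert_of_notMem ht.2] at htk
  have hcard : #(insert a (s ∪ t)) < #S := by
    have h₁ := card_insert_le a (s ∪ t)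
    have h₂ := card_union_le s t
    omega
  obtain ⟨x, hxS, hx⟩ := exists_mem_notMem_of_card_lt_card hcard
  simp only [mem_insert, mem_union, not_or] at hx
  obtain ⟨z, hzs, hzt⟩ := not_disjoint_iff.1
    (h (hshift x hxS _ hs.1 (mem_insert_self a s) (by simp [hx])) ht.1)
  simp only [mem_sdiff, mem_union, mem_insert, mem_singleton] at hzs hzt
  have hzt' := hzt.resolve_left hzs.2
  obtain ⟨(hz | hz) | rfl, hza⟩ := hzs
  · exact hza hz
  · exact disjoint_left.1 hst hz hzt'
  · exact hx.2.2 hzt'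

theorem card_shadow_memberSubfamily_add_le (a : α) (𝒜 : Finset (Finset α)) :
    #(∂ (𝒜.memberSubfamily a)) + #(∂ (𝒜.nonMemberSubfamily a)) ≤ #(∂ 𝒜) := by
  rw [← card_memberSubfamily_add_card_nonMemberSubfamily a (∂ 𝒜)]
  refine add_le_add (card_le_card fun t ht => ?_) (card_le_card fun t ht => ?_)
  · obtain ⟨s, hs, b, hb, rfl⟩ := mem_shadow_iff.1 ht
    rw [mem_memberSubfamily] at hs ⊢
    have hba : a ≠ b := fun hab => hs.2 (hab ▸ hb)
    refine ⟨?_, fun h => hs.2 (mem_of_mem_erase h)⟩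
    rw [← erase_insert_of_ne hba]
    exact erase_mem_shadow hs.1 (mem_insert_of_mem hb)
  · obtain ⟨s, hs, b, hb, rfl⟩ := mem_shadow_iff.1 ht
    rw [mem_nonMemberSubfamily] at hs ⊢
    exact ⟨erase_mem_shadow hs.1 hb, fun h => hs.2 (mem_of_mem_erase h)⟩

/-- **Katona's intersecting shadow theorem** for families on a finite ground set `S`. -/
theorem card_le_card_shadow_of_intersecting_s18 (hsub : ∀ s ∈ 𝒜, s ⊆ S)
    (hk : (𝒜 : Set (Finset α)).Sized k) (h : (𝒜 : Set (Finset α)).Intersecting) :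
    #𝒜 ≤ #(∂ 𝒜) := by
  induction S using Finset.induction_on generalizing 𝒜 k with
  | empty =>
    obtain rfl : 𝒜 = ∅ := eq_empty_of_forall_notMem fun s hs =>
      h.ne_bot hs (subset_empty.1 (hsub s hs))
    simp
  | insert a S ha ih =>
    obtain hS | hS := lt_or_ge #(insert a S) (2 * k)
    · exact card_le_card_shadow_of_card_lt_two_mul hsub hk hS
    induction hm : #{t ∈ 𝒜 | a ∈ t} using Nat.strong_induction_on generalizing 𝒜 with
    | _ m ihm =>
      by_cases hshift : ∀ x ∈ insert a S, ∀ s ∈ 𝒜, a ∈ s → x ∉ s → (s ∪ {x}) \ {a} ∈ 𝒜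
      · have hmem : #(𝒜.memberSubfamily a) ≤ #(∂ (𝒜.memberSubfamily a)) := by
          refine ih (k := k - 1) (fun s hs => ?_) (fun s hs => ?_)
            (intersecting_memberSubfamily_of_shifted h hk hS hshift)
          · rw [mem_memberSubfamily] at hs
            exact (subset_insert_iff_of_notMem hs.2).1
              ((subset_insert a s).trans (hsub _ hs.1))
          · rw [mem_coe, mem_memberSubfamily] at hs
            rw [← hk hs.1, card_insert_of_notMem hs.2, Nat.add_sub_cancel]
        have hnon : #(𝒜.nonMemberSubfamily a) ≤ #(∂ (𝒜.nonMemberSubfamily a)) := by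
          have hle : 𝒜.nonMemberSubfamily a ⊆ 𝒜 := fun s hs => (mem_nonMemberSubfamily.1 hs).1
          refine ih (fun s hs => ?_) (fun s hs => hk (hle hs)) (h.mono (coe_subset.2 hle))
          exact (subset_insert_iff_of_notMem (mem_nonMemberSubfamily.1 hs).2).1 (hsub s (hle hs))
        rw [← card_memberSubfamily_add_card_nonMemberSubfamily a 𝒜]
        exact (add_le_add hmem hnon).trans (card_shadow_memberSubfamily_add_le a 𝒜)
      · push Not at hshift
        obtain ⟨x, hxS, s, hs, has, hxs, hs'⟩ := hshift
        calc #𝒜 = #(𝓒 {x} {a} 𝒜) := (UV.card_compression _ _ _).symm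
          _ ≤ #(∂ (𝓒 {x} {a} 𝒜)) := ihm _
            (hm ▸ card_filter_mem_compression_lt hs has hxs hs')
            (subset_of_mem_compression_singleton hxS hsub)
            (hk.uvCompression (by simp)) (intersecting_compression_singleton h x a) rfl
          _ ≤ #(∂ 𝒜) := UV.card_shadow_compression_le _ _ fun y hy =>
            ⟨a, mem_singleton_self a, by
              rw [mem_singleton.1 hy, erase_singleton, erase_singleton]
              exact UV.isCompressed_self _ _⟩

end IntersectingShadow

/-- Katona: an intersecting family `A` of `k`-element subsets of `[n]` satisfies
`|Δ(A)| ≥ |A|`, where `Δ(A)` is the `(k-1)`-shadow. -/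
theorem katona_shadow_intersecting {n k : ℕ}
    (A : Finset (Finset (Fin n)))
    (hcard : ∀ B ∈ A, B.card = k)
    (hint : ∀ B ∈ A, ∀ B' ∈ A, (B ∩ B').Nonempty) :
    A.card ≤ (shadow A (k - 1)).card := by
  have hk : (A : Set (Finset (Fin n))).Sized k := fun B hB => hcard B hB
  have h : (A : Set (Finset (Fin n))).Intersecting := fun B hB B' hB' =>
    Finset.not_disjoint_iff_nonempty_inter.2 (hint B hB B' hB')
  refine (card_le_card_shadow_of_intersecting_s18 (S := Finset.univ)
    (fun B _ => Finset.subset_univ B) hk h).trans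
    (Finset.card_le_card fun B hB => ?_)
  exact Finset.mem_filter.2
    ⟨Finset.mem_univ B, hk.shadow hB, Finset.exists_subset_of_mem_shadow hB⟩
end

section
/- Let n ≥ 3 and let F be a nonempty family of k-element subsets of [n] with k < n. If k ≥ ⌈n/2 + 1⌉, then |Δ(F)| − |F| ≥ k − 1 ≥ ⌈n/2⌉, where Δ(F) = {B ⊆ [n] : |B| = k−1 and B ⊆ F' for some F' ∈ F} is the (k−1)-shadow of F. -/
open Finset in
/-- A family of `r`-subsets of a set with at most `2r - 1` elements is no larger than its shadow. -/
theorem card_le_card_shadow_of_subset {α : Type*} [DecidableEq α] {S : Finset α} {r : ℕ}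
    {F : Finset (Finset α)} (hS : #S + 1 ≤ 2 * r) (hF : ∀ A ∈ F, A ⊆ S ∧ #A = r) :
    #F ≤ #(Finset.shadow F) := by
  have hr : 0 < r := by lia
  refine Nat.le_of_mul_le_mul_right ?_ hr
  refine card_mul_le_card_mul (fun A B : Finset α => B ⊆ A) (fun A hA => ?_) (fun B hB => ?_)
  · rw [← (hF A hA).2, ← card_image_of_injOn A.erase_injOn]
    refine card_le_card fun B hB => ?_
    obtain ⟨a, ha, rfl⟩ := mem_image.1 hB
    exact mem_filter.2 ⟨erase_mem_shadow hA ha, erase_subset _ _⟩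
  · obtain ⟨A, hA, hBA, hcard⟩ := mem_shadow_iff_exists_mem_card_add_one.1 hB
    have hBS := hBA.trans (hF A hA).1
    have hsdiff := card_sdiff_add_card_eq_card hBS
    rw [(hF A hA).2] at hcard
    calc #(F.bipartiteBelow (fun A B : Finset α => B ⊆ A) B)
        ≤ #((S \ B).image fun a => insert a B) := card_le_card fun C hC => by
          obtain ⟨hCF, hBC⟩ := mem_filter.1 hC
          have hCcard : #C = #B + 1 := (hF C hCF).2.trans hcard
          obtain ⟨a, haB, rfl⟩ :=
            (covBy_iff_card_sdiff_eq_one.2 ⟨hBC, by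
              rw [card_sdiff_of_subset hBC]; lia⟩).exists_finset_insert
          exact mem_image.2 ⟨a, mem_sdiff.2 ⟨(hF _ hCF).1 (mem_insert_self a B), haB⟩, rfl⟩
      _ ≤ #(S \ B) := card_image_le
      _ ≤ r := by lia

open Finset in
theorem shadow_memberSubfamily_subset {α : Type*} [DecidableEq α] (x : α)
    (F : Finset (Finset α)) :
    Finset.shadow (F.memberSubfamily x) ⊆ (Finset.shadow F).memberSubfamily x := by
  intro B hB
  obtain ⟨a, ha, h⟩ := mem_shadow_iff_insert_mem.1 hB
  obtain ⟨hF, hx⟩ := mem_memberSubfamily.1 h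
  rw [mem_insert, not_or] at hx
  refine mem_memberSubfamily.2 ⟨mem_shadow_iff_insert_mem.2 ⟨a, ?_, ?_⟩, hx.2⟩
  · simp [ha, Ne.symm hx.1]
  · rwa [insert_comm]

open Finset in
theorem shadow_nonMemberSubfamily_subset {α : Type*} [DecidableEq α] (x : α)
    (F : Finset (Finset α)) :
    Finset.shadow (F.nonMemberSubfamily x) ⊆ (Finset.shadow F).nonMemberSubfamily x := by
  intro B hB
  obtain ⟨A, hA, hBA⟩ := exists_subset_of_mem_shadow hB
  exact mem_nonMemberSubfamily.2 ⟨shadow_mono (filter_subset _ _) hB,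
    fun hx => (mem_nonMemberSubfamily.1 hA).2 (hBA hx)⟩

open Finset in
/-- A nonempty family of `k`-subsets of a set with at most `2k - 2` elements has at least
`k - 1` fewer members than its shadow. -/
theorem card_add_le_card_shadow_of_subset {α : Type*} [DecidableEq α] {S : Finset α} {k : ℕ}
    {F : Finset (Finset α)} (hne : F.Nonempty) (hS : #S + 2 ≤ 2 * k)
    (hF : ∀ A ∈ F, A ⊆ S ∧ #A = k) :
    #F + (k - 1) ≤ #(Finset.shadow F) := by
  induction S using Finset.strongInduction generalizing F with
  | H S ih =>
  obtain ⟨A, hA⟩ := hne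
  obtain ⟨hAS, hAk⟩ := hF A hA
  by_cases hSA : S ⊆ A
  · obtain rfl : A = S := hAS.antisymm hSA
    have hFA : F = {A} := eq_singleton_iff_unique_mem.2
      ⟨hA, fun B hB => eq_of_subset_of_card_le (hF B hB).1 (by rw [hAk, (hF B hB).2])⟩
    have hle : #A ≤ #(Finset.shadow F) := by
      rw [← card_image_of_injOn A.erase_injOn]
      exact card_le_card (image_subset_iff.2 fun a ha => erase_mem_shadow hA ha)
    rw [hFA] at hle ⊢
    rw [card_singleton]
    lia
  · obtain ⟨x, hxS, hxA⟩ := not_subset.1 hSA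
    have hcard := card_erase_add_one hxS
    have hnonmem := ih (S.erase x) (erase_ssubset hxS) (F := F.nonMemberSubfamily x)
      ⟨A, mem_nonMemberSubfamily.2 ⟨hA, hxA⟩⟩ (by lia) fun B hB => by
        obtain ⟨hBF, hxB⟩ := mem_nonMemberSubfamily.1 hB
        exact ⟨subset_erase.2 ⟨(hF B hBF).1, hxB⟩, (hF B hBF).2⟩
    have hmem := card_le_card_shadow_of_subset (S := S.erase x) (r := k - 1)
      (F := F.memberSubfamily x) (by lia) fun B hB => by
        obtain ⟨hBF, hxB⟩ := mem_memberSubfamily.1 hB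
        obtain ⟨hsub, hBk⟩ := hF _ hBF
        rw [card_insert_of_notMem hxB] at hBk
        exact ⟨subset_erase.2 ⟨(subset_insert x B).trans hsub, hxB⟩, by lia⟩
    have h₁ := card_le_card (shadow_memberSubfamily_subset x F)
    have h₂ := card_le_card (shadow_nonMemberSubfamily_subset x F)
    have h₃ := card_memberSubfamily_add_card_nonMemberSubfamily x F
    have h₄ := card_memberSubfamily_add_card_nonMemberSubfamily x (Finset.shadow F)
    lia


/-- For `n ≥ 3`, a nonempty family `F` of `k`-element subsets of `[n]` with
`⌈n/2 + 1⌉ ≤ k < n` satisfies `|Δ(F)| - |F| ≥ k - 1 ≥ ⌈n/2⌉`, where `Δ(F)` is the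
`(k-1)`-shadow. -/
theorem shadow_strict_growth {n k : ℕ} (hn : 3 ≤ n) (hkn : k < n)
    (F : Finset (Finset (Fin n))) (hne : F.Nonempty)
    (hcard : ∀ B ∈ F, B.card = k)
    (hk : (n + 1) / 2 + 1 ≤ k) :
    F.card + (k - 1) ≤ (shadow F (k - 1)).card ∧ (n + 1) / 2 ≤ k - 1 := by
  refine ⟨?_, by lia⟩
  refine (card_add_le_card_shadow_of_subset (S := Finset.univ) hne
    (by rw [Finset.card_fin]; lia) fun A hA => ⟨A.subset_univ, hcard A hA⟩).trans
    (Finset.card_le_card fun B hB => ?_)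
  obtain ⟨A, hA, hBA, hBcard⟩ := Finset.mem_shadow_iff_exists_mem_card_add_one.1 hB
  rw [hcard A hA] at hBcard
  exact Finset.mem_filter.2 ⟨Finset.mem_univ B, by lia, A, hA, hBA⟩
end
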